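/- arXiv:1407.6730 — 12 statements merged into one kernel-verified Lean document; each statement's English description precedes it below -/
import Mathlib

section
/- Let (X,d) be a metric space whose points carry a linear order. For u,v ∈ X define N(u,v) = {x ∈ X : d(u,x) < d(u,v), or d(u,x) = d(u,v) and x < v} (the set of points strictly closer to u than v under the lexicographic key (d(u,·), ·)). If w lies on a shortest path between u and v, i.e. d(u,w) + d(w,v) = d(u,v), then N(w,v) ⊆ N(u,v). In particular, if X is finite and ℓ is a natural number with |N(u,v)| < ℓ (i.e. v is among the ℓ closest points to u with ties broken by the order), then |N(w,v)| < ℓ (v is among the ℓ closest points to w). -/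
/-- For points `u v` of a metric space with a linear order, `N u v` is the set of points
strictly closer to `u` than `v` under the lexicographic key `(dist u ·, ·)`. -/
def closerSet {X : Type*} [MetricSpace X] [LinearOrder X] (u v : X) : Set X :=
  {x : X | dist u x < dist u v ∨ (dist u x = dist u v ∧ x < v)}

theorem closerSet_subset_of_shortest_path {X : Type*} [MetricSpace X] [LinearOrder X]
    (u v w : X) (hw : dist u w + dist w v = dist u v) :
    closerSet w v ⊆ closerSet u v ∧
      ((Set.univ : Set X).Finite →
        ∀ ℓ : ℕ, (closerSet u v).ncard < ℓ → (closerSet w v).ncard < ℓ) := by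
  have hsub : closerSet w v ⊆ closerSet u v := by
    intro x hx
    have htri := dist_triangle u w x
    rcases hx with hx | ⟨hx, hxv⟩
    · exact Or.inl (by linarith)
    · rcases (show dist u x ≤ dist u v by linarith).lt_or_eq with h | h
      · exact Or.inl h
      · exact Or.inr ⟨h, hxv⟩
  refine ⟨hsub, fun hfin ℓ hℓ => ?_⟩
  exact (Set.ncard_le_ncard hsub (hfin.subset (Set.subset_univ _))).trans_lt hℓ
end

section
/- Let (X,d) be a metric space, A ⊆ X, and define the cluster C_A(w) = {v ∈ X : d(w,v) < d(v,a) for every a ∈ A}. If u ∈ C_A(w) and x lies on a shortest path between u and w, i.e. d(u,x) + d(x,w) = d(u,w), then x ∈ C_A(w). -/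
theorem mem_cluster_of_shortest_path {X : Type*} [MetricSpace X] (A : Set X) (w u x : X)
    (hu : ∀ a ∈ A, dist w u < dist u a)
    (hx : dist u x + dist x w = dist u w) :
    ∀ a ∈ A, dist w x < dist x a := by
  intro a ha
  linarith [hu a ha, dist_triangle u x a, dist_comm w u, dist_comm w x]
end

section
/- Let V be a finite set with |V| = n, let s be an integer with 1 ≤ s ≤ n, and let S_1, …, S_k ⊆ V (k ≥ 1) be sets with |S_i| ≥ s for every i ∈ {1,…,k}. Then there exists a set H ⊆ V such that H ∩ S_i ≠ ∅ for every i ∈ {1,…,k} and |H| ≤ (n/s)·ln k + 1 (as real numbers). -/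
/-- Some point lies in at least the average proportion of the sets of a family. -/
theorem exists_mul_card_le_card_mul_card_filter_mem {V ι : Type*} [Fintype V] [DecidableEq V]
    [Nonempty V] (s : ℕ) (F : Finset ι) (S : ι → Finset V) (hS : ∀ i ∈ F, s ≤ (S i).card) :
    ∃ v : V, s * F.card ≤ Fintype.card V * (F.filter fun i => v ∈ S i).card := by
  by_contra! h
  have hcount : ∑ v : V, (F.filter fun i => v ∈ S i).card = ∑ i ∈ F, (S i).card := by
    simp only [Finset.card_filter]
    rw [Finset.sum_comm]
    simp
  have hle : s * F.card ≤ ∑ i ∈ F, (S i).card := by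
    rw [mul_comm]
    simpa using Finset.card_nsmul_le_sum F (fun i => (S i).card) s hS
  have hlt : ∑ v : V, Fintype.card V * (F.filter fun i => v ∈ S i).card <
      ∑ _v : V, s * F.card :=
    Finset.sum_lt_sum_of_nonempty Finset.univ_nonempty fun v _ => h v
  rw [← Finset.mul_sum, hcount] at hlt
  simp only [Finset.sum_const, Finset.card_univ, smul_eq_mul] at hlt
  exact absurd (Nat.lt_of_mul_lt_mul_left hlt) hle.not_gt

/-- The greedy choice of `t` points leaves at most a fraction `(1 - s / |V|) ^ t` of the sets
unhit. -/
theorem exists_card_le_card_filter_disjoint_le {V ι : Type*} [Fintype V] [DecidableEq V]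
    [Nonempty V] (s : ℕ) (hsn : s ≤ Fintype.card V) (F : Finset ι) (S : ι → Finset V)
    (hS : ∀ i ∈ F, s ≤ (S i).card) (t : ℕ) :
    ∃ H : Finset V, H.card ≤ t ∧ ((F.filter fun i => Disjoint H (S i)).card : ℝ) ≤
      F.card * (1 - (s : ℝ) / Fintype.card V) ^ t := by
  have hn : (0 : ℝ) < Fintype.card V := by exact_mod_cast Fintype.card_pos
  induction t with
  | zero => exact ⟨∅, by simp⟩
  | succ t ih =>
    obtain ⟨H, hH, hbound⟩ := ih
    set G := F.filter fun i => Disjoint H (S i) with hG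
    obtain ⟨v, hv⟩ := exists_mul_card_le_card_mul_card_filter_mem s G S
      fun i hi => hS i (Finset.mem_filter.1 hi).1
    refine ⟨insert v H, (Finset.card_insert_le v H).trans (by lia), ?_⟩
    have hfilter : (F.filter fun i => Disjoint (insert v H) (S i)) =
        G.filter fun i => v ∉ S i := by
      ext i
      simp only [hG, Finset.mem_filter, Finset.disjoint_insert_left]
      tauto
    have hsplit : ((G.filter fun i => v ∈ S i).card : ℝ) +
        (G.filter fun i => v ∉ S i).card = G.card := by
      exact_mod_cast Finset.card_filter_add_card_filter_not (s := G) fun i => v ∈ S i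
    have hv' : (s : ℝ) / Fintype.card V * G.card ≤ (G.filter fun i => v ∈ S i).card := by
      rw [div_mul_eq_mul_div, div_le_iff₀' hn]
      exact_mod_cast hv
    have hfrac : 0 ≤ 1 - (s : ℝ) / Fintype.card V := by
      rw [sub_nonneg, div_le_one hn]
      exact_mod_cast hsn
    rw [hfilter, pow_succ, ← mul_assoc]
    calc ((G.filter fun i => v ∉ S i).card : ℝ)
        ≤ G.card * (1 - (s : ℝ) / Fintype.card V) := by linarith
      _ ≤ _ := mul_le_mul_of_nonneg_right hbound hfrac

theorem hitting_set {V : Type*} [Fintype V] [DecidableEq V] (n s k : ℕ)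
    (hn : n = Fintype.card V) (hs1 : 1 ≤ s) (hsn : s ≤ n) (hk : 1 ≤ k)
    (S : Fin k → Finset V) (hS : ∀ i, s ≤ (S i).card) :
    ∃ H : Finset V, (∀ i, (H ∩ S i).Nonempty) ∧
      (H.card : ℝ) ≤ ((n : ℝ) / s) * Real.log k + 1 := by
  subst hn
  have : Nonempty V := Fintype.card_pos_iff.1 (by lia)
  have hn : (0 : ℝ) < Fintype.card V := by exact_mod_cast Fintype.card_pos
  have hs : (0 : ℝ) < s := by exact_mod_cast hs1
  have hk' : (1 : ℝ) ≤ k := by exact_mod_cast hk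
  set x := (Fintype.card V : ℝ) / s * Real.log k with hx
  have hx0 : 0 ≤ x := mul_nonneg (by positivity) (Real.log_nonneg hk')
  obtain ⟨H, hH, hbound⟩ := exists_card_le_card_filter_disjoint_le s hsn Finset.univ S
    (fun i _ => hS i) (⌊x⌋₊ + 1)
  refine ⟨H, fun i => ?_, ?_⟩
  · have hfrac : 0 ≤ 1 - (s : ℝ) / Fintype.card V := by
      rw [sub_nonneg, div_le_one hn]
      exact_mod_cast hsn
    have hlog : Real.log k < (⌊x⌋₊ + 1 : ℕ) * ((s : ℝ) / Fintype.card V) := by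
      have hlt : x < (⌊x⌋₊ + 1 : ℕ) := by exact_mod_cast Nat.lt_floor_add_one x
      calc Real.log k = x * ((s : ℝ) / Fintype.card V) := by rw [hx]; field_simp
        _ < _ := mul_lt_mul_of_pos_right hlt (by positivity)
    have hunhit : ((Finset.univ.filter fun i => Disjoint H (S i)).card : ℝ) < 1 := by
      calc ((Finset.univ.filter fun i => Disjoint H (S i)).card : ℝ)
          ≤ k * (1 - (s : ℝ) / Fintype.card V) ^ (⌊x⌋₊ + 1) := by simpa using hbound
        _ ≤ k * Real.exp (-((s : ℝ) / Fintype.card V)) ^ (⌊x⌋₊ + 1) := by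
          gcongr
          exact Real.one_sub_le_exp_neg _
        _ = Real.exp (Real.log k - (⌊x⌋₊ + 1 : ℕ) * ((s : ℝ) / Fintype.card V)) := by
          rw [← Real.exp_nat_mul, sub_eq_add_neg, Real.exp_add, Real.exp_log (by linarith),
            mul_neg]
        _ < 1 := Real.exp_lt_one_iff.2 (by linarith)
    have hempty : (Finset.univ.filter fun i => Disjoint H (S i)) = ∅ := by
      rw [← Finset.card_eq_zero]
      exact Nat.lt_one_iff.1 (by exact_mod_cast hunhit)
    rw [← Finset.not_disjoint_iff_nonempty_inter]
    exact Finset.filter_eq_empty_iff.1 hempty (Finset.mem_univ i)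
  · calc (H.card : ℝ) ≤ (⌊x⌋₊ + 1 : ℕ) := by exact_mod_cast hH
      _ ≤ x + 1 := by
        push_cast
        linarith [Nat.floor_le hx0]
end

section
/- There exists a constant α ≥ 1 such that the following holds. For every finite set V with n = |V| ≥ 2, every integer q with 1 ≤ q ≤ n, and every family of sets S_1, …, S_k ⊆ V with 1 ≤ k ≤ n² and |S_i| ≥ α·q·ln n for every i ∈ {1,…,k}, there exists a coloring c : V → {1,…,q} such that: (1) for every i ∈ {1,…,k} and every color j ∈ {1,…,q} there exists w ∈ S_i with c(w) = j; and (2) for every j ∈ {1,…,q}, the number of elements of V of color j is at most 2n/q. -/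
/-- Among all families of shifts `f : B → G`, those for which no point of `T ⊆ B × G`, shifted
within its fibre, lands on `j` make up a fraction of at most `exp (-|T| / |G|)`. -/
theorem card_shifts_avoiding_le {B G : Type*} [Fintype B] [DecidableEq B] [AddCommGroup G]
    [Fintype G] [DecidableEq G] (T : Finset (B × G)) (j : G) :
    ((Finset.univ.filter (fun f : B → G => ∀ p ∈ T, p.2 + f p.1 ≠ j)).card : ℝ) ≤
      (Fintype.card G : ℝ) ^ Fintype.card B *
        Real.exp (-((T.card : ℝ) / Fintype.card G)) := by
  have hG : (0 : ℝ) < Fintype.card G := by exact_mod_cast Fintype.card_pos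
  let F : B → Finset G := fun b => (T.filter (fun p => p.1 = b)).image (fun p => j - p.2)
  have hF : ∀ b, (F b).card = (T.filter (fun p => p.1 = b)).card := by
    intro b
    refine Finset.card_image_of_injOn ?_
    rintro ⟨x₁, x₂⟩ hx ⟨y₁, y₂⟩ hy hxy
    simp_all
  have hset : Finset.univ.filter (fun f : B → G => ∀ p ∈ T, p.2 + f p.1 ≠ j) =
      Fintype.piFinset (fun b => (F b)ᶜ) := by
    ext f
    simp only [Finset.mem_filter, Finset.mem_univ, true_and, Fintype.mem_piFinset,
      Finset.mem_compl, F, Finset.mem_image, not_exists, not_and, and_imp]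
    constructor
    · rintro h b p hp rfl hj
      exact h p hp (by rw [← hj]; abel)
    · intro h p hp hj
      exact h p.1 p hp rfl (by rw [← hj]; abel)
  have hsum : ∑ b, ((F b).card : ℝ) = T.card := by
    simp only [hF]
    exact_mod_cast (Finset.card_eq_sum_card_fiberwise (f := Prod.fst) (s := T)
      (t := Finset.univ) (fun _ _ => by simp)).symm
  rw [hset, Fintype.card_piFinset, Nat.cast_prod]
  calc ∏ b, (((F b)ᶜ.card : ℕ) : ℝ)
      ≤ ∏ b, (Fintype.card G : ℝ) * Real.exp (-(((F b).card : ℝ) / Fintype.card G)) := by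
        refine Finset.prod_le_prod (fun _ _ => by positivity) fun b _ => ?_
        rw [Finset.card_compl, Nat.cast_sub (Finset.card_le_univ _)]
        have h := Real.add_one_le_exp (-(((F b).card : ℝ) / Fintype.card G))
        calc (Fintype.card G : ℝ) - (F b).card
            = Fintype.card G * (-(((F b).card : ℝ) / Fintype.card G) + 1) := by
              field_simp
              ring
          _ ≤ _ := by gcongr
    _ = _ := by
        rw [Finset.prod_mul_distrib, Finset.prod_const, Finset.card_univ, ← Real.exp_sum,
          Finset.sum_neg_distrib, ← Finset.sum_div, hsum]

/-- If the sets `T i ⊆ B × G` are large, some family of shifts makes each of them hit every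
element of `G`. -/
theorem exists_shifts_hitting {ι B G : Type*} [Fintype ι] [Fintype B] [AddCommGroup G]
    [Fintype G] (T : ι → Finset (B × G)) (t : ℝ)
    (hT : ∀ i, Fintype.card G * t ≤ (T i).card)
    (ht : (Fintype.card ι * Fintype.card G : ℝ) * Real.exp (-t) < 1) :
    ∃ f : B → G, ∀ i j, ∃ p ∈ T i, p.2 + f p.1 = j := by
  classical
  have hG : (0 : ℝ) < Fintype.card G := by exact_mod_cast Fintype.card_pos
  by_contra! hbad
  let A : ι × G → Finset (B → G) := fun x =>
    Finset.univ.filter (fun f : B → G => ∀ p ∈ T x.1, p.2 + f p.1 ≠ x.2)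
  have hcover : (Finset.univ : Finset (B → G)) ⊆ Finset.univ.biUnion A := by
    intro f _
    obtain ⟨i, j, h⟩ := hbad f
    exact Finset.mem_biUnion.2 ⟨(i, j), Finset.mem_univ _, by simpa [A] using h⟩
  have hA : ∀ x, ((A x).card : ℝ) ≤
      (Fintype.card G : ℝ) ^ Fintype.card B * Real.exp (-t) := by
    intro x
    refine (card_shifts_avoiding_le (T x.1) x.2).trans ?_
    gcongr
    rw [le_div_iff₀ hG, mul_comm]
    exact hT x.1
  have hcard : (Fintype.card G : ℝ) ^ Fintype.card B ≤ ∑ x, ((A x).card : ℝ) := by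
    have h := (Finset.card_le_card hcover).trans Finset.card_biUnion_le
    rw [Finset.card_univ, Fintype.card_fun] at h
    exact_mod_cast h
  have hle := hcard.trans (Finset.sum_le_sum fun x _ => hA x)
  rw [Finset.sum_const, Finset.card_univ, Fintype.card_prod, nsmul_eq_mul, Nat.cast_mul] at hle
  have hpow : (0 : ℝ) < (Fintype.card G : ℝ) ^ Fintype.card B := by positivity
  nlinarith

theorem coloring_lemma :
    ∃ α : ℝ, 1 ≤ α ∧
      ∀ (V : Type) [Fintype V] (n q k : ℕ), n = Fintype.card V → 2 ≤ n →
        1 ≤ q → q ≤ n → 1 ≤ k → k ≤ n ^ 2 →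
        ∀ S : Fin k → Finset V, (∀ i, α * q * Real.log n ≤ ((S i).card : ℝ)) →
          ∃ c : V → Fin q,
            (∀ i : Fin k, ∀ j : Fin q, ∃ w ∈ S i, c w = j) ∧
            (∀ j : Fin q,
              ((Finset.univ.filter (fun v => c v = j)).card : ℝ) ≤ 2 * n / q) := by
  refine ⟨4, by norm_num, fun V _ n q k hn hn2 hq hqn _ hkn S hS => ?_⟩
  have : NeZero q := ⟨by omega⟩
  have hq0 : (0 : ℝ) < q := by exact_mod_cast hq
  have hn0 : (0 : ℝ) < n := by exact_mod_cast (by omega : 0 < n)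
  obtain ⟨e⟩ : Nonempty (V ↪ Fin (n / q + 1) × Fin q) := by
    apply Function.Embedding.nonempty_of_card_le
    rw [Fintype.card_prod, Fintype.card_fin, Fintype.card_fin, ← hn, mul_comm]
    exact (Nat.lt_mul_div_succ n hq).le
  obtain ⟨f, hf⟩ := exists_shifts_hitting (fun i => (S i).map e) (4 * Real.log n)
    (fun i => by
      rw [Fintype.card_fin, Finset.card_map]
      linarith [hS i])
    (by
      have hexp : Real.exp (-(4 * Real.log n)) = ((n : ℝ) ^ 4)⁻¹ := by
        rw [Real.exp_neg, mul_comm, Real.exp_mul, Real.exp_log hn0]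
        norm_cast
      rw [Fintype.card_fin, Fintype.card_fin, hexp, ← div_eq_mul_inv,
        div_lt_one (by positivity)]
      have hlt : k * q < n ^ 4 := calc
        k * q ≤ n ^ 2 * n := Nat.mul_le_mul hkn hqn
        _ = n ^ 3 := by ring
        _ < n ^ 4 := Nat.pow_lt_pow_right (by omega) (by norm_num)
      exact_mod_cast hlt)
  refine ⟨fun v => (e v).2 + f (e v).1, fun i j => ?_, fun j => ?_⟩
  · obtain ⟨p, hp, hpj⟩ := hf i j
    obtain ⟨w, hw, rfl⟩ := Finset.mem_map.1 hp
    exact ⟨w, hw, hpj⟩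
  · have hcard : (Finset.univ.filter (fun v => (e v).2 + f (e v).1 = j)).card ≤ n / q + 1 := by
      refine (Finset.card_le_card_of_injOn (t := Finset.univ) (fun v => (e v).1)
        (fun _ _ => by simp) ?_).trans_eq (Finset.card_fin _)
      intro v hv w hw hvw
      simp only [Finset.coe_filter, Finset.mem_univ, true_and, Set.mem_ofPred_eq] at hv hw hvw
      refine e.injective (Prod.ext hvw ?_)
      rw [← hw, hvw] at hv
      exact add_right_cancel hv
    have hdiv : ((n / q : ℕ) : ℝ) ≤ n / q := Nat.cast_div_le
    have hone : (1 : ℝ) ≤ n / q := by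
      rw [le_div_iff₀ hq0, one_mul]
      exact_mod_cast hqn
    calc ((Finset.univ.filter (fun v => (e v).2 + f (e v).1 = j)).card : ℝ)
        ≤ ((n / q + 1 : ℕ) : ℝ) := by exact_mod_cast hcard
      _ ≤ n / q + n / q := by
          push_cast
          linarith
      _ = 2 * n / q := by ring
end

section
/- There exists a constant c ≥ 1 such that the following holds. For every finite metric space (V,d) with n = |V| ≥ 2 and every integer s with 1 ≤ s ≤ n, there exists a set A ⊆ V such that |A| ≤ c·s·ln n and, for every w ∈ V, the cluster C_A(w) = {v ∈ V : d(w,v) < d(v,a) for every a ∈ A} has at most 4n/s elements. -/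
open Finset in
/-- Among `k + 1` samples, the first one is the strict minimiser of `g` in at most a `1 / (k + 1)`
fraction of the cases. -/
lemma card_first_strict_min_le {α : Type*} [Fintype α] (g : α → ℝ) (k : ℕ) :
    (k + 1) * Nat.card {p : Fin (k + 1) → α // ∀ j, j ≠ 0 → g (p 0) < g (p j)}
      ≤ Fintype.card α ^ (k + 1) := by
  classical
  let E : Fin (k + 1) → Finset (Fin (k + 1) → α) :=
    fun i => univ.filter fun p => ∀ j, j ≠ i → g (p i) < g (p j)
  have hE : ∀ i, #(E i) = #(E 0) := by
    intro i
    refine card_equiv (Equiv.arrowCongr (Equiv.swap i 0) (Equiv.refl α)) fun p => ?_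
    simp only [E, mem_filter, mem_univ, true_and, Equiv.arrowCongr_apply, Function.comp,
      Equiv.symm_swap, Equiv.refl_apply, Equiv.swap_apply_right]
    constructor
    · intro h j hj
      exact h _ fun h' => hj ((Equiv.swap i 0).injective (by simp [h']))
    · intro h j hj
      simpa using h (Equiv.swap i 0 j) fun h' => hj ((Equiv.swap i 0).injective (by simp [h']))
  have hdisj : Set.PairwiseDisjoint (univ : Finset (Fin (k + 1))) E := by
    intro i _ j _ hij
    refine disjoint_left.2 fun p hi hj => ?_
    simp only [E, mem_filter, mem_univ, true_and] at hi hj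
    exact lt_asymm (hi j hij.symm) (hj i hij)
  have h := card_le_univ (univ.biUnion E)
  rw [card_biUnion hdisj] at h
  simp only [hE, sum_const, card_univ, Fintype.card_fin, smul_eq_mul, Fintype.card_fun] at h
  rwa [Nat.card_eq_fintype_card, Fintype.card_subtype]

open Finset Classical in
/-- Summed over all `k`-tuples of samples, the number of points strictly below every sample. -/
lemma sum_card_below_samples_le {α : Type*} [Fintype α] (g : α → ℝ) (k : ℕ) :
    (k + 1) * ∑ f : Fin k → α, #{w | ∀ i, g w < g (f i)} ≤ Fintype.card α ^ (k + 1) := by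
  refine le_trans (le_of_eq ?_) (card_first_strict_min_le g k)
  congr 1
  simp only [← Fintype.card_subtype]
  rw [← Fintype.card_sigma, ← Nat.card_eq_fintype_card]
  refine Nat.card_congr
    { toFun := fun x => ⟨Fin.cons x.2.1 x.1, fun j hj => ?_⟩
      invFun := fun p => ⟨Fin.tail p.1, p.1 0, fun i => p.2 i.succ (Fin.succ_ne_zero i)⟩
      left_inv := fun x => by rcases x with ⟨f, w, h⟩; rfl
      right_inv := fun p => Subtype.ext (Fin.cons_self_tail p.1) }
  obtain ⟨i, rfl⟩ := Fin.exists_succ_eq.2 hj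
  simpa using x.2.2 i

open Finset Classical in
/-- Some `s` points of `W` make the clusters of the points of `W` small on average. -/
lemma exists_centers_sum_cluster_le {V : Type*} [Fintype V] [MetricSpace V] (s : ℕ)
    (W : Finset V) (hW : W.Nonempty) :
    ∃ A : Finset V, #A ≤ s ∧
      s * ∑ w ∈ W, #{v | ∀ a ∈ A, dist w v < dist v a} ≤ Fintype.card V * #W := by
  have : Nonempty W := hW.to_subtype
  obtain ⟨f, -, hf⟩ : ∃ f ∈ (univ : Finset (Fin s → W)),
      s * ∑ v : V, #{w : W | ∀ i, dist v w < dist v (f i)} ≤ Fintype.card V * #W := by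
    refine exists_le_of_sum_le univ_nonempty ?_
    rw [← mul_sum, sum_comm, mul_sum]
    calc _ ≤ ∑ v : V, #W ^ (s + 1) := sum_le_sum fun v _ => by
          have h := sum_card_below_samples_le (fun w : W => dist v w) s
          rw [Fintype.card_coe] at h
          exact (Nat.mul_le_mul_right _ s.le_succ).trans h
      _ = _ := by simp; ring
  refine ⟨univ.image fun i => (f i : V), card_image_le.trans (by simp), ?_⟩
  refine le_trans (le_of_eq ?_) hf
  congr 1
  simp only [card_filter, mem_image, mem_univ, true_and, forall_exists_index,
    forall_apply_eq_imp_iff]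
  rw [sum_comm]
  refine sum_congr rfl fun v _ => ?_
  rw [← sum_coe_sort W]
  simp only [dist_comm]

open Finset Classical in
/-- `s * T` centers suffice to make the clusters of fewer than `4 ^ T` points small. -/
lemma exists_centers_cluster_le {V : Type*} [Fintype V] [MetricSpace V] (s T : ℕ)
    (W : Finset V) (hW : #W < 4 ^ T) :
    ∃ A : Finset V, #A ≤ s * T ∧
      ∀ w ∈ W, s * #{v | ∀ a ∈ A, dist w v < dist v a} ≤ 4 * Fintype.card V := by
  induction T generalizing W with
  | zero => exact ⟨∅, by simp, by simp_all⟩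
  | succ T ih =>
    rcases W.eq_empty_or_nonempty with rfl | hne
    · exact ⟨∅, by simp, by simp⟩
    obtain ⟨A, hA, hsum⟩ := exists_centers_sum_cluster_le s W hne
    have : Nonempty V := ⟨hne.choose⟩
    let L := W.filter fun w =>
      4 * Fintype.card V < s * #{v | ∀ a ∈ A, dist w v < dist v a}
    have hL : #L * (4 * Fintype.card V) ≤ Fintype.card V * #W := by
      calc _ ≤ ∑ w ∈ L, s * #{v | ∀ a ∈ A, dist w v < dist v a} := by
            rw [← smul_eq_mul]
            exact card_nsmul_le_sum _ _ _ fun w hw => (mem_filter.1 hw).2.le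
        _ ≤ ∑ w ∈ W, s * #{v | ∀ a ∈ A, dist w v < dist v a} :=
            sum_le_sum_of_subset (filter_subset _ _)
        _ ≤ _ := by rwa [← mul_sum]
    have hL' : 4 * #L ≤ #W :=
      Nat.le_of_mul_le_mul_left (by linarith) (Fintype.card_pos (α := V))
    obtain ⟨B, hB, hBL⟩ := ih L (by rw [pow_succ] at hW; omega)
    have hmono : ∀ (w : V) (D : Finset V), D ⊆ A ∪ B →
        s * #{v | ∀ a ∈ A ∪ B, dist w v < dist v a} ≤ s * #{v | ∀ a ∈ D, dist w v < dist v a} :=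
      fun w D hD => Nat.mul_le_mul_left s <| card_le_card <|
        monotone_filter_right _ fun v _ hv a ha => hv a (hD ha)
    refine ⟨A ∪ B, (card_union_le A B).trans (by rw [mul_add]; omega), fun w hw => ?_⟩
    by_cases hwL : w ∈ L
    · exact (hmono w B subset_union_right).trans (hBL w hwL)
    · refine (hmono w A subset_union_left).trans ?_
      by_contra! h
      exact hwL (mem_filter.2 ⟨hw, h⟩)

theorem clusters_lemma :
    ∃ c : ℝ, 1 ≤ c ∧
      ∀ (V : Type) [Fintype V] [MetricSpace V] (n s : ℕ), n = Fintype.card V → 2 ≤ n →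
        1 ≤ s → s ≤ n →
        ∃ A : Finset V, (A.card : ℝ) ≤ c * s * Real.log n ∧
          ∀ w : V,
            (({v : V | ∀ a ∈ A, dist w v < dist v a}.ncard : ℝ)) ≤ 4 * n / s := by
  classical
  refine ⟨4, by norm_num, fun V _ _ n s hn h2 hs _ => ?_⟩
  obtain ⟨A, hA, hAw⟩ := exists_centers_cluster_le s (Nat.log 4 n + 1) (Finset.univ : Finset V)
    (by rw [Finset.card_univ, ← hn]; exact Nat.lt_pow_succ_log_self (by norm_num) n)
  have hs0 : (0 : ℝ) < s := by exact_mod_cast hs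
  refine ⟨A, ?_, fun w => ?_⟩
  · have hlog2 : Real.log 2 ≤ Real.log n :=
      Real.log_le_log (by norm_num) (by exact_mod_cast h2)
    have hlog4 : Real.log 4 = 2 * Real.log 2 := by
      rw [show (4 : ℝ) = 2 ^ 2 by norm_num, Real.log_pow]; norm_num
    have hpow : (Nat.log 4 n : ℝ) * Real.log 4 ≤ Real.log n := by
      rw [← Real.log_pow]
      exact Real.log_le_log (by positivity)
        (by exact_mod_cast Nat.pow_log_le_self 4 (by omega : n ≠ 0))
    have hT : (Nat.log 4 n : ℝ) + 1 ≤ 4 * Real.log n := by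
      have := Real.log_two_gt_d9
      have : (0 : ℝ) ≤ Nat.log 4 n := by positivity
      nlinarith
    calc (A.card : ℝ) ≤ s * (Nat.log 4 n + 1) := by exact_mod_cast hA
      _ ≤ s * (4 * Real.log n) := by gcongr
      _ = _ := by ring
  · rw [le_div_iff₀ hs0, Set.ncard_eq_toFinset_card', Set.toFinset_ofPred, mul_comm, hn]
    exact_mod_cast hAw w (Finset.mem_univ w)
end

section
/- Let ℓ ≥ 1 be an integer and let x_0, …, x_ℓ and y_0, …, y_ℓ be real numbers in the interval [0,1] such that x_0 = y_0 = 0 and x_i + y_{ℓ−i} ≤ 1 for every i ∈ {0,…,ℓ}. Then there exists an index i ∈ {0,…,ℓ−1} such that x_i + y_{ℓ−i−1} ≤ 1 − 1/ℓ. -/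
theorem exists_index_le_one_sub_inv (ℓ : ℕ) (hℓ : 1 ≤ ℓ) (x y : ℕ → ℝ)
    (hx : ∀ i ≤ ℓ, x i ∈ Set.Icc (0 : ℝ) 1) (hy : ∀ i ≤ ℓ, y i ∈ Set.Icc (0 : ℝ) 1)
    (hx0 : x 0 = 0) (hy0 : y 0 = 0)
    (hsum : ∀ i ≤ ℓ, x i + y (ℓ - i) ≤ 1) :
    ∃ i < ℓ, x i + y (ℓ - i - 1) ≤ 1 - 1 / (ℓ : ℝ) := by
  obtain ⟨m, rfl⟩ : ∃ m, ℓ = m + 1 := ⟨ℓ - 1, by omega⟩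
  -- Both families of sums have the same total, since `x 0 = y 0 = 0`.
  have total : ∑ i ∈ Finset.range (m + 1), (x i + y (m + 1 - i - 1)) =
      ∑ i ∈ Finset.range m, (x (i + 1) + y (m + 1 - (i + 1))) := by
    rw [Finset.sum_add_distrib, Finset.sum_add_distrib, Finset.sum_range_succ',
      Finset.sum_range_succ, hx0]
    have h : ∀ i, m + 1 - i - 1 = m + 1 - (i + 1) := fun i => by omega
    simp [h, hy0]
  have upper : ∑ i ∈ Finset.range m, (x (i + 1) + y (m + 1 - (i + 1))) ≤ m := by
    refine (Finset.sum_le_card_nsmul _ _ 1 fun i hi => hsum (i + 1) ?_).trans (by simp)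
    have := Finset.mem_range.mp hi
    omega
  have const : ∑ _i ∈ Finset.range (m + 1), (1 - 1 / ((m + 1 : ℕ) : ℝ)) = m := by
    rw [Finset.sum_const, Finset.card_range, nsmul_eq_mul]
    push_cast
    field_simp
    ring
  obtain ⟨i, hi, hle⟩ := Finset.exists_le_of_sum_le (Finset.nonempty_range_add_one (n := m))
    ((total.trans_le upper).trans_eq const.symm)
  exact ⟨i, Finset.mem_range.mp hi, hle⟩
end

section
/- Let G be a connected simple graph on a finite vertex set, let u and v be vertices, let r be a natural number, let D ≥ 1 be a natural number, and let S be a set of vertices such that every vertex x with dist(u,x) ≤ r belongs to S and every vertex x ∈ S satisfies dist(u,x) ≤ r + 1, where dist denotes the graph distance (length of a shortest path). If there exists a vertex w ∈ S with dist(w,v) < D, then there exists a vertex w ∈ S with dist(w,v) < D and dist(u,w) + dist(w,v) = dist(u,v), i.e., some such vertex lies on a shortest path between u and v. -/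
/-- In a connected graph, a shortest path from `u` to `v` has a vertex at each distance
`n ≤ G.dist u v` from `u`. -/
theorem SimpleGraph.Connected.exists_dist_eq_and_dist_add_dist_eq {V : Type*}
    {G : SimpleGraph V} (hG : G.Connected) {u v : V} {n : ℕ} (hn : n ≤ G.dist u v) :
    ∃ w, G.dist u w = n ∧ G.dist u w + G.dist w v = G.dist u v := by
  obtain ⟨p, hp⟩ := hG.exists_walk_length_eq_dist u v
  have h_take := SimpleGraph.dist_le (p.take n)
  have h_drop := SimpleGraph.dist_le (p.drop n)
  rw [p.take_length] at h_take
  rw [p.drop_length] at h_drop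
  have h_triangle := hG.dist_triangle (u := u) (v := p.getVert n) (w := v)
  exact ⟨p.getVert n, by omega, by omega⟩

theorem exists_on_shortest_path_in_intersection {V : Type*} [Fintype V]
    (G : SimpleGraph V) (hG : G.Connected) (u v : V) (r D : ℕ) (hD : 1 ≤ D)
    (S : Set V)
    (hS1 : ∀ x : V, G.dist u x ≤ r → x ∈ S)
    (hS2 : ∀ x ∈ S, G.dist u x ≤ r + 1)
    (h : ∃ w ∈ S, G.dist w v < D) :
    ∃ w ∈ S, G.dist w v < D ∧ G.dist u w + G.dist w v = G.dist u v := by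
  obtain ⟨w, hwS, hwD⟩ := h
  by_cases hw : G.dist u w + G.dist w v = G.dist u v
  · exact ⟨w, hwS, hwD, hw⟩
  · have h_triangle := hG.dist_triangle (u := u) (v := w) (w := v)
    have hwr := hS2 w hwS
    obtain ⟨x, hx, hxv⟩ :=
      hG.exists_dist_eq_and_dist_add_dist_eq (min_le_right r (G.dist u v))
    exact ⟨x, hS1 x (by omega), by omega, hxv⟩
end

section
/- Let b > 1 be a real number, let t be a natural number, let α_0, …, α_{t−1} be nonnegative real numbers, and let δ_0, …, δ_t be nonnegative real numbers such that δ_{i+1} ≤ δ_i − α_i·(1 − 1/b) for every i ∈ {0,…,t−1}. Then (Σ_{i=0}^{t−1} α_i)·(1 + 1/b) + δ_t ≤ (1 + 2/(b−1))·δ_0. -/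
/-- A sequence that drops by at least `α i * c` at each step `i < t` has dropped by at least
`(∑ i < t, α i) * c` after `t` steps. -/
theorem sum_range_mul_le_sub_of_step {t : ℕ} {α δ : ℕ → ℝ} {c : ℝ}
    (hstep : ∀ i < t, δ (i + 1) ≤ δ i - α i * c) :
    (∑ i ∈ Finset.range t, α i) * c ≤ δ 0 - δ t := by
  rw [Finset.sum_mul, ← Finset.sum_range_sub']
  refine Finset.sum_le_sum fun i hi => ?_
  linarith [hstep i (Finset.mem_range.mp hi)]

theorem routing_progress_sum (b : ℝ) (hb : 1 < b) (t : ℕ) (α δ : ℕ → ℝ)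
    (hα : ∀ i < t, 0 ≤ α i) (hδ : ∀ i ≤ t, 0 ≤ δ i)
    (hstep : ∀ i < t, δ (i + 1) ≤ δ i - α i * (1 - 1 / b)) :
    (∑ i ∈ Finset.range t, α i) * (1 + 1 / b) + δ t ≤ (1 + 2 / (b - 1)) * δ 0 := by
  have hsum := sum_range_mul_le_sub_of_step hstep
  have hb0 : b ≠ 0 := by positivity
  have hb1 : 0 < b - 1 := sub_pos.mpr hb
  have hratio : 1 + 1 / b = (1 + 2 / (b - 1)) * (1 - 1 / b) := by
    field_simp
    ring
  have hK : 0 ≤ 2 / (b - 1) := by positivity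
  have hδt := mul_nonneg hK (hδ t le_rfl)
  have hmul := mul_le_mul_of_nonneg_left hsum (add_nonneg zero_le_one hK)
  rw [hratio]
  linarith
end

section
/- Let (X,d) be a metric space, let u, v ∈ X, let A, A' ⊆ X be nonempty sets, and let p ∈ A be a point with d(v,p) = infDist(v,A) (p is a nearest point of A to v). If d(u,p) ≥ infDist(u,A'), then infDist(v,A') ≤ 2·d(u,v) + d(v,p). -/
theorem infDist_step {X : Type*} [MetricSpace X] (u v : X) (A A' : Set X)
    (hA : A.Nonempty) (hA' : A'.Nonempty) (p : X) (hp : p ∈ A)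
    (hpd : dist v p = Metric.infDist v A)
    (h : Metric.infDist u A' ≤ dist u p) :
    Metric.infDist v A' ≤ 2 * dist u v + dist v p := by
  have h_lip : Metric.infDist v A' ≤ Metric.infDist u A' + dist v u :=
    Metric.infDist_le_infDist_add_dist
  linarith [dist_triangle u v p, dist_comm u v]
end

section
/- Let (X,d) be a metric space, let u, v ∈ X, let i be a natural number, let A_0, …, A_i ⊆ X be nonempty sets with v ∈ A_0, and let p_0, …, p_i ∈ X be points such that p_j ∈ A_j and d(v,p_j) = infDist(v,A_j) for every j ∈ {0,…,i}. If d(u, p_{j−1}) ≥ infDist(u, A_j) for every j ∈ {1,…,i}, then d(v, p_i) ≤ 2i·d(u,v). -/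
theorem thorup_zwick_level_bound {X : Type*} [MetricSpace X] (u v : X) (i : ℕ)
    (A : ℕ → Set X) (p : ℕ → X)
    (hA : ∀ j ≤ i, (A j).Nonempty)
    (hv : v ∈ A 0)
    (hp : ∀ j ≤ i, p j ∈ A j)
    (hpd : ∀ j ≤ i, dist v (p j) = Metric.infDist v (A j))
    (h : ∀ j < i, Metric.infDist u (A (j + 1)) ≤ dist u (p j)) :
    dist v (p i) ≤ 2 * i * dist u v := by
  suffices key : ∀ j ≤ i, dist v (p j) ≤ 2 * j * dist u v from key i le_rfl
  intro j
  induction j with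
  | zero =>
    intro hj
    simp [hpd 0 hj, Metric.infDist_zero_of_mem hv]
  | succ j ih =>
    intro hj
    calc dist v (p (j + 1)) = Metric.infDist v (A (j + 1)) := hpd _ hj
      _ ≤ Metric.infDist u (A (j + 1)) + dist v u := Metric.infDist_le_infDist_add_dist
      _ ≤ dist u (p j) + dist v u := by gcongr; exact h j hj
      _ ≤ dist u v + dist v (p j) + dist v u := by gcongr; exact dist_triangle u v (p j)
      _ ≤ dist u v + 2 * j * dist u v + dist v u := by gcongr; exact ih (by lia)
      _ = 2 * (j + 1 : ℕ) * dist u v := by rw [dist_comm v u]; push_cast; ring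
end

section
/- Let ℓ ≥ 1 be an integer, let Δ be a real number, and let a_0, …, a_ℓ and b_0, …, b_ℓ be nonnegative real numbers such that a_0 = 0, b_0 = 0, and a_i + b_{ℓ−i} ≤ Δ − 1 for every i ∈ {0,…,ℓ}. Then there exists an index j ∈ {0,…,ℓ−1} such that either j = 0 and b_{ℓ−1} ≤ (1 − 1/ℓ)·Δ, or j ≥ 1 and a_j + 1 + b_{ℓ−j−1} ≤ (1 − 1/ℓ)·Δ. -/
theorem exists_level_minus (ℓ : ℕ) (hℓ : 1 ≤ ℓ) (Δ : ℝ) (a b : ℕ → ℝ)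
    (ha : ∀ i ≤ ℓ, 0 ≤ a i) (hb : ∀ i ≤ ℓ, 0 ≤ b i)
    (ha0 : a 0 = 0) (hb0 : b 0 = 0)
    (hsum : ∀ i ≤ ℓ, a i + b (ℓ - i) ≤ Δ - 1) :
    ∃ j < ℓ, (j = 0 ∧ b (ℓ - 1) ≤ (1 - 1 / (ℓ : ℝ)) * Δ) ∨
      (1 ≤ j ∧ a j + 1 + b (ℓ - j - 1) ≤ (1 - 1 / (ℓ : ℝ)) * Δ) := by
  obtain ⟨n, rfl⟩ : ∃ n, ℓ = n + 1 := ⟨ℓ - 1, by omega⟩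
  by_contra! hcon
  set t := (1 - 1 / ((n + 1 : ℕ) : ℝ)) * Δ with ht
  have hmean : ((n : ℝ) + 1) * t = n * Δ := by
    rw [ht]
    push_cast
    field_simp
    ring
  have hzero : t < b n := (hcon 0 (by omega)).1 rfl
  have hsucc : ∑ _j ∈ Finset.range n, t ≤
      ∑ j ∈ Finset.range n, (a (j + 1) + 1 + b (n - 1 - j)) := by
    refine Finset.sum_le_sum fun j hj => ?_
    have hjn := Finset.mem_range.mp hj
    have h := (hcon (j + 1) (by omega)).2 (by omega)
    rw [show n + 1 - (j + 1) - 1 = n - 1 - j by omega] at h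
    exact h.le
  have hupper : ∑ j ∈ Finset.range n, (a (j + 1) + 1 + b (n - 1 - j + 1)) ≤
      ∑ _j ∈ Finset.range n, Δ := by
    refine Finset.sum_le_sum fun j hj => ?_
    have hjn := Finset.mem_range.mp hj
    have h := hsum (j + 1) (by omega)
    rw [show n + 1 - (j + 1) = n - 1 - j + 1 by omega] at h
    linarith
  have hshift : ∑ k ∈ Finset.range n, b k + b n = ∑ k ∈ Finset.range n, b (k + 1) := by
    rw [← Finset.sum_range_succ, Finset.sum_range_succ', hb0, add_zero]
  rw [Finset.sum_add_distrib, Finset.sum_range_reflect b] at hsucc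
  rw [Finset.sum_add_distrib, Finset.sum_range_reflect (fun k => b (k + 1))] at hupper
  simp only [Finset.sum_const, Finset.card_range, nsmul_eq_mul] at hsucc hupper
  linarith
end

section
/- Let ℓ ≥ 1 be an integer, let Δ be a real number, and let a_0, …, a_ℓ and b_0, …, b_ℓ be nonnegative real numbers such that a_0 = 0, b_0 = 0, and a_i + b_{ℓ−i} ≤ Δ − 1 for every i ∈ {0,…,ℓ}. Then there exists an index j ∈ {1,…,ℓ} such that a_j + 1 + b_{ℓ−j+1} ≤ (1 + 1/ℓ)·Δ. -/
theorem exists_level_plus (ℓ : ℕ) (hℓ : 1 ≤ ℓ) (Δ : ℝ) (a b : ℕ → ℝ)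
    (ha : ∀ i ≤ ℓ, 0 ≤ a i) (hb : ∀ i ≤ ℓ, 0 ≤ b i)
    (ha0 : a 0 = 0) (hb0 : b 0 = 0)
    (hsum : ∀ i ≤ ℓ, a i + b (ℓ - i) ≤ Δ - 1) :
    ∃ j, 1 ≤ j ∧ j ≤ ℓ ∧ a j + 1 + b (ℓ - j + 1) ≤ (1 + 1 / (ℓ : ℝ)) * Δ := by
  have hℓ0 : (ℓ : ℝ) ≠ 0 := by
    have : ℓ ≠ 0 := by omega
    exact_mod_cast this
  have hshift : ∑ k ∈ Finset.range ℓ, (a (k + 1) + b (ℓ - k)) =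
      ∑ i ∈ Finset.range (ℓ + 1), (a i + b (ℓ - i)) := by
    rw [Finset.sum_add_distrib, Finset.sum_add_distrib, Finset.sum_range_succ' a,
      Finset.sum_range_succ (fun i => b (ℓ - i)), Nat.sub_self, ha0, hb0, add_zero, add_zero]
  have htotal : ∑ i ∈ Finset.range (ℓ + 1), (a i + b (ℓ - i)) ≤ ((ℓ : ℝ) + 1) * (Δ - 1) := by
    have h := Finset.sum_le_card_nsmul (Finset.range (ℓ + 1)) (fun i => a i + b (ℓ - i)) (Δ - 1)
      fun i hi => hsum i (Nat.lt_succ_iff.mp (Finset.mem_range.mp hi))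
    simpa using h
  have hle : ∑ k ∈ Finset.range ℓ, (a (k + 1) + 1 + b (ℓ - k)) ≤
      ∑ _k ∈ Finset.range ℓ, (1 + 1 / (ℓ : ℝ)) * Δ := by
    have hsplit : ∑ k ∈ Finset.range ℓ, (a (k + 1) + 1 + b (ℓ - k)) =
        ∑ k ∈ Finset.range ℓ, (a (k + 1) + b (ℓ - k)) + ℓ := by
      simp only [add_right_comm _ (1 : ℝ), Finset.sum_add_distrib (g := fun _ => (1 : ℝ))]
      simp
    have hconst : (ℓ : ℝ) * ((1 + 1 / (ℓ : ℝ)) * Δ) = (ℓ + 1) * Δ := by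
      field_simp
    rw [hsplit, hshift, Finset.sum_const, Finset.card_range, nsmul_eq_mul, hconst]
    linarith
  obtain ⟨k, hk, hkle⟩ :=
    Finset.exists_le_of_sum_le (Finset.nonempty_range_iff.mpr (by omega)) hle
  have hkℓ := Finset.mem_range.mp hk
  refine ⟨k + 1, by omega, by omega, ?_⟩
  rwa [show ℓ - (k + 1) + 1 = ℓ - k by omega]
end
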